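/- arXiv:1708.08418 — 3 statements merged into one kernel-verified Lean document; each statement's English description precedes it below -/
import Mathlib

section
/- Let q ≥ 2 be an integer with 3 | (q+1), and let x be an integer with 1 ≤ x ≤ (q+1)/3. Then x occurs in exactly (q−2)/3 triples of T. -/
open Finset

/-- For `q` with `3 ∣ q+1`, the set of triples `(k,l,m)` of integers with
`1 ≤ k < l ≤ (q+1)/3`, `l < m ≤ q+1`, and `k + l + m = q+1`. -/
def T (q : ℕ) : Finset (ℕ × ℕ × ℕ) :=
  (Finset.Icc 1 ((q+1)/3) ×ˢ Finset.Icc 1 ((q+1)/3) ×ˢ Finset.Icc 1 (q+1)).filter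
    (fun t => t.1 < t.2.1 ∧ t.2.1 < t.2.2 ∧ t.1 + t.2.1 + t.2.2 = q+1)

/-- The number of triples of `T q` in which the integer `x` occurs. -/
def occ (q x : ℕ) : ℕ :=
  ((T q).filter (fun t => t.1 = x ∨ t.2.1 = x ∨ t.2.2 = x)).card

theorem stmt_14 (q : ℕ) (hq : 2 ≤ q) (h3 : 3 ∣ (q+1))
    (x : ℕ) (hx1 : 1 ≤ x) (hx : x ≤ (q+1)/3) :
    occ q x = (q - 2) / 3 := by
  have hcard : ((Finset.Icc 1 ((q + 1) / 3)).erase x).card = (q - 2) / 3 := by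
    rw [Finset.card_erase_of_mem (Finset.mem_Icc.mpr ⟨hx1, hx⟩), Nat.card_Icc]
    omega
  rw [← hcard, occ]
  -- A triple containing `x` is determined by the other of its two smaller entries.
  refine Finset.card_nbij' (fun t => t.1 + t.2.1 - x)
    (fun y => (min x y, max x y, q + 1 - x - y)) ?_ ?_ ?_ ?_
  · rintro ⟨k, l, m⟩ h
    simp [T] at h ⊢
    omega
  · intro y h
    simp [T] at h ⊢
    omega
  · rintro ⟨k, l, m⟩ h
    simp [T] at h ⊢
    omega
  · intro y h
    simp
end

section
/- Let q ≥ 2 be an integer with 3 | (q+1), and let i be an integer with 1 ≤ i ≤ (q−2)/3. Then the element (q+1)/3 + i occurs in exactly ⌈i/2⌉ triples of T, and the element q − i occurs in exactly ⌊i/2⌋ triples of T. -/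
open Finset

/-- An element `x > (q+1)/3` can only be the largest entry of a triple, so the triples containing
it are parametrized by their smallest entry. -/
lemma occ_eq_card_Icc (q x n s : ℕ) (hn : q + 1 = 3 * n) (hx : n < x) (hs : x + s = 3 * n) :
    occ q x = (Finset.Icc (max 1 (s - n)) ((s - 1) / 2)).card := by
  unfold occ
  rw [← Finset.card_image_of_injective (f := fun k : ℕ => (k, s - k, x)) _
    (fun a b h => (Prod.mk.inj h).1)]
  congr 1
  ext ⟨k, l, m⟩
  have hq : (q + 1) / 3 = n := by omega
  simp only [T, hq, Finset.mem_filter, Finset.mem_product, Finset.mem_Icc, Finset.mem_image,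
    Prod.mk.injEq]
  constructor
  · intro h
    exact ⟨k, by omega, rfl, by omega, by omega⟩
  · rintro ⟨a, ha, rfl, rfl, rfl⟩
    omega

theorem stmt_15 (q : ℕ) (hq : 2 ≤ q) (h3 : 3 ∣ (q+1))
    (i : ℕ) (hi1 : 1 ≤ i) (hi : i ≤ (q-2)/3) :
    occ q ((q+1)/3 + i) = (i + 1) / 2 ∧ occ q (q - i) = i / 2 := by
  obtain ⟨n, hn⟩ := h3
  have hd : (q + 1) / 3 = n := by omega
  constructor
  · rw [hd, occ_eq_card_Icc q (n + i) n (2 * n - i) hn (by omega) (by omega), Nat.card_Icc]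
    omega
  · rw [occ_eq_card_Icc q (q - i) n (i + 1) hn (by omega) (by omega), Nat.card_Icc]
    omega
end

section
/- Let q ≥ 2 be an integer with 3 | (q+1), and let ω ∈ ℂ be a primitive third root of unity. Then Σ_{(k,l,m)∈T} (ω^{k−l} + ω^{l−k}) = −(q+1)/3 if 9 | (q+1), and Σ_{(k,l,m)∈T} (ω^{k−l} + ω^{l−k}) = −(q−2)/3 if 9 ∤ (q+1). -/
open Finset

/-- Summing over `T q` amounts to summing over the pairs `k < l ≤ (q+1)/3`. -/
lemma sum_T_eq_sum_range {M : Type*} [AddCommMonoid M] (q n : ℕ) (hn : q + 1 = 3 * n)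
    (f : ℕ → ℕ → M) :
    ∑ t ∈ T q, f t.1 t.2.1 = ∑ l ∈ range n, ∑ k ∈ range l, f (k + 1) (l + 1) := by
  have hdiv : (q + 1) / 3 = n := by omega
  rw [Finset.sum_sigma']
  refine Finset.sum_nbij' (fun t => ⟨t.2.1 - 1, t.1 - 1⟩)
    (fun p => (p.2 + 1, p.1 + 1, 3 * n - (p.2 + 1) - (p.1 + 1))) ?_ ?_ ?_ ?_ ?_
  · rintro ⟨k, l, m⟩ h
    simp only [T, mem_filter, mem_product, mem_Icc, hdiv] at h
    simp only [mem_sigma, mem_range]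
    omega
  · rintro ⟨l, k⟩ h
    simp only [mem_sigma, mem_range] at h
    simp only [T, mem_filter, mem_product, mem_Icc, hdiv]
    omega
  · rintro ⟨k, l, m⟩ h
    simp only [T, mem_filter, mem_product, mem_Icc, hdiv] at h
    simp only [Prod.mk.injEq]
    omega
  · rintro ⟨l, k⟩ _
    simp
  · rintro ⟨k, l, m⟩ h
    simp only [T, mem_filter, mem_product, mem_Icc, hdiv] at h
    simp only [Nat.sub_add_cancel h.1.1.1, Nat.sub_add_cancel h.1.2.1.1]

/-- The off-diagonal part of a product of two finite geometric sums with inverse ratios. -/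
lemma sum_zpow_sub_add_zpow_sub {K : Type*} [Field K] {x : K} (hx : x ≠ 0) (n : ℕ) :
    ∑ l ∈ range n, ∑ k ∈ range l, (x ^ ((k : ℤ) - l) + x ^ ((l : ℤ) - k))
      = (∑ k ∈ range n, x ^ k) * (∑ k ∈ range n, x⁻¹ ^ k) - n := by
  induction n with
  | zero => simp
  | succ n ih =>
    have hstep : ∑ k ∈ range n, (x ^ ((k : ℤ) - n) + x ^ ((n : ℤ) - k))
        = (∑ k ∈ range n, x ^ k) * x⁻¹ ^ n + x ^ n * ∑ k ∈ range n, x⁻¹ ^ k := by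
      rw [Finset.sum_mul, Finset.mul_sum, ← Finset.sum_add_distrib]
      refine Finset.sum_congr rfl fun k _ => ?_
      simp only [zpow_sub₀ hx, zpow_natCast, inv_pow, div_eq_mul_inv]
    have hinv : x ^ n * x⁻¹ ^ n = 1 := by
      rw [← mul_pow, mul_inv_cancel₀ hx, one_pow]
    simp only [Finset.sum_range_succ _ n, ih, hstep]
    push_cast
    linear_combination -hinv

lemma IsPrimitiveRoot.sub_one_mul_inv_sub_one {K : Type*} [Field K] {x : K}
    (hx : IsPrimitiveRoot x 3) : (x - 1) * (x⁻¹ - 1) = 3 := by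
  have hsum : 1 + x + x ^ 2 = 0 := by
    simpa [Finset.sum_range_succ] using hx.geom_sum_eq_zero (by norm_num)
  have hinv : x * x⁻¹ = 1 := mul_inv_cancel₀ (hx.ne_zero (by norm_num))
  linear_combination (2 + x) * hinv - x⁻¹ * hsum

lemma IsPrimitiveRoot.geom_sum_mul_geom_sum_inv {K : Type*} [Field K] [CharZero K] {x : K}
    (hx : IsPrimitiveRoot x 3) (n : ℕ) :
    (∑ k ∈ range n, x ^ k) * (∑ k ∈ range n, x⁻¹ ^ k) = if 3 ∣ n then 0 else 1 := by
  have h1 := geom_sum_mul x n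
  have h2 := geom_sum_mul x⁻¹ n
  have h3 := hx.sub_one_mul_inv_sub_one
  have key : 3 * ((∑ k ∈ range n, x ^ k) * (∑ k ∈ range n, x⁻¹ ^ k))
      = (x ^ n - 1) * ((x ^ n)⁻¹ - 1) := by
    rw [← inv_pow, ← h1, ← h2, ← h3]
    ring
  have hthree : (3 : K) ≠ 0 := by norm_num
  split_ifs with h
  · rw [(hx.pow_eq_one_iff_dvd n).2 h] at key
    simpa using key
  · have hcop : Nat.Coprime n 3 := ((Nat.Prime.coprime_iff_not_dvd Nat.prime_three).2 h).symm
    rw [(hx.pow_of_coprime n hcop).sub_one_mul_inv_sub_one] at key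
    exact mul_left_cancel₀ hthree (by rw [key, mul_one])

theorem stmt_17 (q : ℕ) (hq : 2 ≤ q) (h3 : 3 ∣ (q+1))
    (ω : ℂ) (hω : IsPrimitiveRoot ω 3) :
    (9 ∣ (q+1) →
      ∑ t ∈ T q, (ω ^ ((t.1 : ℤ) - (t.2.1 : ℤ)) + ω ^ ((t.2.1 : ℤ) - (t.1 : ℤ)))
        = -((q : ℂ) + 1) / 3) ∧
    (¬ (9 ∣ (q+1)) →
      ∑ t ∈ T q, (ω ^ ((t.1 : ℤ) - (t.2.1 : ℤ)) + ω ^ ((t.2.1 : ℤ) - (t.1 : ℤ)))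
        = -((q : ℂ) - 2) / 3) := by
  obtain ⟨n, hn⟩ := h3
  have hsum : ∑ t ∈ T q, (ω ^ ((t.1 : ℤ) - (t.2.1 : ℤ)) + ω ^ ((t.2.1 : ℤ) - (t.1 : ℤ)))
      = (if 3 ∣ n then 0 else 1) - (n : ℂ) := by
    rw [sum_T_eq_sum_range q n hn fun k l => ω ^ ((k : ℤ) - (l : ℤ)) + ω ^ ((l : ℤ) - (k : ℤ)),
      ← hω.geom_sum_mul_geom_sum_inv n, ← sum_zpow_sub_add_zpow_sub (hω.ne_zero (by norm_num)) n]
    simp only [Nat.cast_add, Nat.cast_one, add_sub_add_right_eq_sub]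
  have hq' : (q : ℂ) + 1 = 3 * n := by exact_mod_cast hn
  rw [hsum]
  refine ⟨fun h9 => ?_, fun h9 => ?_⟩
  · rw [if_pos (by omega)]
    linear_combination hq' / 3
  · rw [if_neg (by omega)]
    linear_combination hq' / 3
end
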